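/- arXiv:2307.13678 — 4 statements merged into one kernel-verified Lean document; each statement's English description precedes it below -/
import Mathlib

section
/- Let C ∈ ℝ^{m×ν} and Q ∈ ℝ^{ν×ν}, and let C̃ = [Cᵀ, −Cᵀ]ᵀ ∈ ℝ^{2m×ν} be the vertical concatenation of C and −C. Then there exists a Metzler matrix Λ̃ ∈ ℝ^{2m×2m} (i.e., all off-diagonal entries of Λ̃ are nonnegative) such that C̃Q = Λ̃C̃ and Λ̃𝟏 = 0, where 𝟏 is the all-ones vector in ℝ^{2m}, if and only if there exists a matrix Λ ∈ ℝ^{m×m} such that CQ = ΛC and μ_∞(Λ) ≤ 0. -/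
/-- The logarithmic norm induced by the ℓ∞ norm:
`μ_∞(A) = max_i (A_{ii} + Σ_{k≠i} |A_{ik}|)`. -/
noncomputable def muInf {ι : Type*} [Fintype ι] [DecidableEq ι]
    (A : Matrix ι ι ℝ) : ℝ :=
  ⨆ i, (A i i + ∑ k ∈ Finset.univ.erase i, |A i k|)

/-- There exists a Metzler matrix `Λ̃ ∈ ℝ^{2m×2m}` with
`C̃ Q = Λ̃ C̃` (where `C̃ = [Cᵀ, −Cᵀ]ᵀ`) and `Λ̃ 𝟏 = 0` iff there exists
`Λ ∈ ℝ^{m×m}` with `C Q = Λ C` and `μ_∞(Λ) ≤ 0`. -/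
theorem stmt0 {m ν : ℕ} (C : Matrix (Fin m) (Fin ν) ℝ)
    (Q : Matrix (Fin ν) (Fin ν) ℝ) :
    (∃ Λt : Matrix (Fin m ⊕ Fin m) (Fin m ⊕ Fin m) ℝ,
      (∀ i j, i ≠ j → 0 ≤ Λt i j) ∧
      Matrix.fromRows C (-C) * Q = Λt * Matrix.fromRows C (-C) ∧
      Λt.mulVec (fun _ => (1 : ℝ)) = 0) ↔
    (∃ Λ : Matrix (Fin m) (Fin m) ℝ, C * Q = Λ * C ∧ muInf Λ ≤ 0) := by
  constructor
  · rintro ⟨L, hM, hQ, h1⟩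
    refine ⟨L.toBlocks₁₁ - L.toBlocks₁₂, ?_, ?_⟩
    · ext i j
      have h := congrFun (congrFun hQ (Sum.inl i)) j
      simp only [Matrix.mul_apply, Matrix.fromRows_apply_inl, Fintype.sum_sum_type,
        Matrix.fromRows_apply_inr, Matrix.neg_apply, mul_neg, Finset.sum_neg_distrib] at h
      simp only [Matrix.mul_apply, Matrix.sub_apply, Matrix.toBlocks₁₁, Matrix.toBlocks₁₂,
        Matrix.of_apply, sub_mul, Finset.sum_sub_distrib]
      linarith
    · unfold muInf
      apply Real.iSup_nonpos
      intro i
      have h := congrFun h1 (Sum.inl i)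
      simp only [Matrix.mulVec, dotProduct, Fintype.sum_sum_type, mul_one, Pi.zero_apply] at h
      rw [← Finset.add_sum_erase _ _ (Finset.mem_univ i),
        ← Finset.add_sum_erase (a := i) _ (fun k => L (Sum.inl i) (Sum.inr k))
          (Finset.mem_univ i)] at h
      have hB : 0 ≤ L (Sum.inl i) (Sum.inr i) := hM _ _ (by simp)
      have hs : ∑ k ∈ Finset.univ.erase i, |L (Sum.inl i) (Sum.inl k) - L (Sum.inl i) (Sum.inr k)|
          ≤ ∑ k ∈ Finset.univ.erase i, (L (Sum.inl i) (Sum.inl k) + L (Sum.inl i) (Sum.inr k)) := by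
        apply Finset.sum_le_sum
        intro k hk
        have hki : i ≠ k := (Finset.ne_of_mem_erase hk).symm
        have a := hM (Sum.inl i) (Sum.inl k) (by simpa using hki)
        have b := hM (Sum.inl i) (Sum.inr k) (by simp)
        rw [abs_le]
        constructor <;> linarith
      rw [Finset.sum_add_distrib] at hs
      simp only [Matrix.sub_apply, Matrix.toBlocks₁₁, Matrix.toBlocks₁₂, Matrix.of_apply]
      linarith
  · rintro ⟨L, hQ, hmu⟩
    have hs : ∀ i, L i i + ∑ k ∈ Finset.univ.erase i, |L i k| ≤ 0 := fun i =>
      (le_ciSup (f := fun i => L i i + ∑ k ∈ Finset.univ.erase i, |L i k|)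
        (Set.finite_range _).bddAbove i).trans hmu
    obtain ⟨d, hd⟩ : ∃ d : Fin m → ℝ, ∀ i,
        d i = -(L i i + ∑ k ∈ Finset.univ.erase i, |L i k|) / 2 := ⟨_, fun _ => rfl⟩
    have hd0 : ∀ i, 0 ≤ d i := fun i => by rw [hd]; linarith [hs i]
    obtain ⟨A, hA⟩ : ∃ A : Matrix (Fin m) (Fin m) ℝ, ∀ i k,
        A i k = if i = k then L i i + d i else max (L i k) 0 :=
      ⟨Matrix.of fun i k => if i = k then L i i + d i else max (L i k) 0, fun _ _ => rfl⟩
    obtain ⟨B, hB⟩ : ∃ B : Matrix (Fin m) (Fin m) ℝ, ∀ i k,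
        B i k = if i = k then d i else max (-L i k) 0 :=
      ⟨Matrix.of fun i k => if i = k then d i else max (-L i k) 0, fun _ _ => rfl⟩
    have hAB : A - B = L := by
      ext i k
      rw [Matrix.sub_apply, hA, hB]
      split_ifs with h
      · subst h; ring
      · rcases le_total (L i k) 0 with h | h
        · rw [max_eq_right h, max_eq_left (by linarith)]; ring
        · rw [max_eq_left h, max_eq_right (by linarith)]; ring
    have hB0 : ∀ i k, 0 ≤ B i k := fun i k => by
      rw [hB]; split_ifs
      · exact hd0 i
      · exact le_max_right _ _
    have hA0 : ∀ i k, i ≠ k → 0 ≤ A i k := fun i k h => by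
      rw [hA, if_neg h]; exact le_max_right _ _
    have hsum : ∀ i, ∑ k, A i k + ∑ k, B i k = 0 := fun i => by
      rw [← Finset.sum_add_distrib, ← Finset.add_sum_erase _ _ (Finset.mem_univ i)]
      have : ∑ k ∈ Finset.univ.erase i, (A i k + B i k)
          = ∑ k ∈ Finset.univ.erase i, |L i k| := by
        apply Finset.sum_congr rfl
        intro k hk
        have hki : i ≠ k := (Finset.ne_of_mem_erase hk).symm
        rw [hA, hB, if_neg hki, if_neg hki]
        rcases le_total (L i k) 0 with h | h
        · rw [max_eq_right h, max_eq_left (by linarith), abs_of_nonpos h]; ring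
        · rw [max_eq_left h, max_eq_right (by linarith), abs_of_nonneg h]; ring
      rw [this, hA, hB, if_pos rfl, if_pos rfl]
      linarith [hd i]
    refine ⟨Matrix.fromBlocks A B B A, ?_, ?_, ?_⟩
    · rintro (i | i) (j | j) h
      · exact hA0 i j (by simpa using h)
      · exact hB0 i j
      · exact hB0 i j
      · exact hA0 i j (by simpa using h)
    · rw [Matrix.fromRows_mul, Matrix.fromBlocks_mul_fromRows, Matrix.neg_mul, hQ, ← hAB]
      congr 1
      · rw [Matrix.sub_mul, Matrix.mul_neg, sub_eq_add_neg]
      · rw [Matrix.sub_mul, Matrix.mul_neg, neg_sub, sub_eq_add_neg]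
    · ext (i | i)
      · simpa [Matrix.mulVec, dotProduct] using hsum i
      · simpa [Matrix.mulVec, dotProduct, add_comm] using hsum i
end

section
/- For every reactant–reaction pair ℓ it holds that ΓQ_ℓ = J_ℓΓ. Moreover, if B ∈ ℝ^{m×n} and Λ_ℓ ∈ ℝ^{m×m} satisfy BΓQ_ℓ = Λ_ℓBΓ, and D is a matrix whose rows form a basis of the left null space {w ∈ ℝ^n : wᵀΓ = 0} of Γ, then there exists a matrix Y_ℓ such that BJ_ℓ = Λ_ℓB + Y_ℓD. -/
/-- `Q_ℓ = e_{j_ℓ} γ_{i_ℓ}ᵀ ∈ ℝ^{ν×ν}` for the reactant–reaction pair `p = (i_ℓ, j_ℓ)`. -/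
def Qmat {n ν : ℕ} (Γ : Matrix (Fin n) (Fin ν) ℝ) (p : Fin n × Fin ν) :
    Matrix (Fin ν) (Fin ν) ℝ :=
  Matrix.of fun a b => if a = p.2 then Γ p.1 b else 0

/-- `J_ℓ = Γ_{j_ℓ} e_{i_ℓ}ᵀ ∈ ℝ^{n×n}` for the reactant–reaction pair `p = (i_ℓ, j_ℓ)`. -/
def Jmat {n ν : ℕ} (Γ : Matrix (Fin n) (Fin ν) ℝ) (p : Fin n × Fin ν) :
    Matrix (Fin n) (Fin n) ℝ :=
  Matrix.of fun a b => if b = p.1 then Γ a p.2 else 0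

/-- `pair` enumerates without repetition exactly the pairs `(i,j)` with `α_{ij} > 0`. -/
def PairEnum {n ν s : ℕ} (α : Matrix (Fin n) (Fin ν) ℝ)
    (pair : Fin s → Fin n × Fin ν) : Prop :=
  Function.Injective pair ∧ ∀ p : Fin n × Fin ν, (∃ ℓ, pair ℓ = p) ↔ 0 < α p.1 p.2

/-- For every reactant–reaction pair `ℓ`, `Γ Q_ℓ = J_ℓ Γ`; moreover,
if `B Γ Q_ℓ = Λ_ℓ B Γ` and the rows of `D` form a basis of the left null space of `Γ`,
then `B J_ℓ = Λ_ℓ B + Y_ℓ D` for some matrix `Y_ℓ`. -/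
theorem stmt3 {n ν s m d : ℕ}
    (α β : Matrix (Fin n) (Fin ν) ℝ)
    (hα : ∀ i j, 0 ≤ α i j) (hβ : ∀ i j, 0 ≤ β i j)
    (Γ : Matrix (Fin n) (Fin ν) ℝ) (hΓ : Γ = β - α)
    (pair : Fin s → Fin n × Fin ν) (hpair : PairEnum α pair)
    (B : Matrix (Fin m) (Fin n) ℝ) (Λ : Fin s → Matrix (Fin m) (Fin m) ℝ)
    (D : Matrix (Fin d) (Fin n) ℝ)
    (hD_indep : LinearIndependent ℝ (fun k : Fin d => D k))
    (hD_span : Submodule.span ℝ (Set.range fun k : Fin d => D k) =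
      {w : Fin n → ℝ | Matrix.vecMul w Γ = 0}) :
    (∀ ℓ : Fin s, Γ * Qmat Γ (pair ℓ) = Jmat Γ (pair ℓ) * Γ) ∧
    (∀ ℓ : Fin s, B * Γ * Qmat Γ (pair ℓ) = Λ ℓ * (B * Γ) →
      ∃ Y : Matrix (Fin m) (Fin d) ℝ, B * Jmat Γ (pair ℓ) = Λ ℓ * B + Y * D) := by
  have h1 : ∀ p : Fin n × Fin ν, Γ * Qmat Γ p = Jmat Γ p * Γ := by
    intro p
    ext a b
    simp [Matrix.mul_apply, Qmat, Jmat]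
  refine ⟨fun ℓ => h1 _, ?_⟩
  intro ℓ h
  have h0 : (B * Jmat Γ (pair ℓ) - Λ ℓ * B) * Γ = 0 := by
    rw [Matrix.sub_mul, Matrix.mul_assoc, ← h1, ← Matrix.mul_assoc, h, Matrix.mul_assoc, sub_self]
  have h2 : ∀ r : Fin m, ∃ c : Fin d → ℝ,
      ∑ k, c k • D k = (B * Jmat Γ (pair ℓ) - Λ ℓ * B) r := by
    intro r
    have hm : (B * Jmat Γ (pair ℓ) - Λ ℓ * B) r ∈
        {w : Fin n → ℝ | Matrix.vecMul w Γ = 0} := by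
      have := congrFun h0 r
      rw [Matrix.mul_apply_eq_vecMul] at this
      exact this
    rw [← hD_span] at hm
    exact (Submodule.mem_span_range_iff_exists_fun ℝ).1 hm
  choose Y hY using h2
  refine ⟨Matrix.of Y, ?_⟩
  rw [← sub_eq_iff_eq_add']
  ext r j
  have := congrFun (hY r) j
  rw [← this]
  simp [Matrix.mul_apply, Finset.sum_apply]
end

section
/- Let Λ ∈ ℝ^{m×m} be weakly contractive. Then there exist θ̄ > 0 and natural numbers m_1,…,m_m such that for every θ ∈ (0, θ̄) there exists c < 0 for which the diagonal matrix P_θ = diag((1+θ)^{m_1},…,(1+θ)^{m_m}) satisfies μ_∞(P_θ Λ P_θ^{-1}) ≤ c < 0. -/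
/-- Row measure `σ_i(Λ) = Λ_{ii} + Σ_{j≠i} |Λ_{ij}|`. -/
noncomputable def sigmaRow {m : ℕ} (Λ : Matrix (Fin m) (Fin m) ℝ) (i : Fin m) : ℝ :=
  Λ i i + ∑ j ∈ Finset.univ.erase i, |Λ i j|

/-- A matrix `Λ` is weakly contractive: `σ_i(Λ) ≤ 0` for all `i`, and every index
with `σ_i(Λ) = 0` is chained via nonzero entries of `Λ` (through indices with
`σ = 0`) to an index with strictly negative row measure. -/
def WeaklyContractive {m : ℕ} (Λ : Matrix (Fin m) (Fin m) ℝ) : Prop :=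
  (∀ i, sigmaRow Λ i ≤ 0) ∧
  ∀ i, sigmaRow Λ i = 0 →
    ∃ (k : ℕ) (c : Fin (k + 1) → Fin m), c 0 = i ∧
      (∀ t : Fin k, Λ (c t.castSucc) (c t.succ) ≠ 0) ∧
      (∀ t : Fin k, sigmaRow Λ (c t.castSucc) = 0) ∧
      sigmaRow Λ (c (Fin.last k)) < 0

open Filter Topology in
lemma aux_neg {f : ℝ → ℝ} {D : ℝ} (h : HasDerivAt f D 0) (h0 : f 0 < 0 ∨ (f 0 = 0 ∧ D < 0)) :
    ∀ᶠ x in 𝓝[>] (0 : ℝ), f x < 0 := by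
  rcases h0 with h0 | ⟨h0, hD⟩
  · exact (h.continuousAt.eventually (gt_mem_nhds h0)).filter_mono nhdsWithin_le_nhds
  · have h1 := (hasDerivAt_iff_tendsto_slope.1 h).eventually (gt_mem_nhds hD)
    have h2 : ∀ᶠ x in 𝓝[>] (0 : ℝ), slope f 0 x < 0 :=
      h1.filter_mono (nhdsWithin_mono _ (fun x hx => ne_of_gt hx))
    filter_upwards [h2, self_mem_nhdsWithin] with x hx hx0
    have hx0' : (0 : ℝ) < x := hx0
    rw [slope_def_field, h0, sub_zero, sub_zero] at hx
    rcases div_neg_iff.1 hx with h | h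
    · linarith
    · exact h.1

lemma aux_deriv (a b : ℕ) :
    HasDerivAt (fun x : ℝ => (1 + x) ^ a * ((1 + x) ^ b)⁻¹) ((a : ℝ) - b) 0 := by
  have h : HasDerivAt (fun x : ℝ => 1 + x) 1 0 := (hasDerivAt_id 0).const_add 1
  have h3 := (h.pow a).mul ((h.pow b).inv (by simp))
  refine HasDerivAt.congr_deriv (f := fun x : ℝ => (1 + x) ^ a * ((1 + x) ^ b)⁻¹) h3 ?_
  simp
  ring

/-- `reachNeg Λ n i`: a chain of length `n` leads from `i` to a row of negative measure. -/
def reachNeg {m : ℕ} (Λ : Matrix (Fin m) (Fin m) ℝ) : ℕ → Fin m → Prop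
  | 0, i => sigmaRow Λ i < 0
  | n + 1, i => ∃ j, Λ i j ≠ 0 ∧ reachNeg Λ n j

lemma reach_of_chain {m : ℕ} (Λ : Matrix (Fin m) (Fin m) ℝ) (k : ℕ) :
    ∀ c : Fin (k + 1) → Fin m, (∀ t : Fin k, Λ (c t.castSucc) (c t.succ) ≠ 0) →
      sigmaRow Λ (c (Fin.last k)) < 0 → reachNeg Λ k (c 0) := by
  induction k with
  | zero => intro c _ h; exact h
  | succ k ih =>
    intro c h1 h2
    refine ⟨c 1, h1 0, ih (fun t => c t.succ) (fun t => h1 t.succ) h2⟩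

lemma exists_rank {m : ℕ} (Λ : Matrix (Fin m) (Fin m) ℝ) (hΛ : WeaklyContractive Λ) :
    ∃ d : Fin m → ℕ, ∀ i, sigmaRow Λ i = 0 → ∃ j, Λ i j ≠ 0 ∧ d j < d i := by
  classical
  have hex : ∀ i, ∃ n, reachNeg Λ n i := by
    intro i
    rcases (hΛ.1 i).lt_or_eq with h | h
    · exact ⟨0, h⟩
    · obtain ⟨k, c, h0, h1, _, h3⟩ := hΛ.2 i h
      exact ⟨k, h0 ▸ reach_of_chain Λ k c h1 h3⟩
  refine ⟨fun i => Nat.find (hex i), fun i hi => ?_⟩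
  have hs := Nat.find_spec (hex i)
  rcases hn : Nat.find (hex i) with _ | n
  · rw [hn] at hs
    exact absurd hi (ne_of_lt hs)
  · rw [hn] at hs
    obtain ⟨j, hj, hr⟩ := hs
    refine ⟨j, hj, ?_⟩
    show Nat.find (hex j) < Nat.find (hex i)
    rw [hn]
    exact Nat.lt_succ_of_le (Nat.find_min' (hex j) hr)

lemma exists_exps {m : ℕ} (Λ : Matrix (Fin m) (Fin m) ℝ) (hΛ : WeaklyContractive Λ) :
    ∃ e : Fin m → ℕ, ∀ i, sigmaRow Λ i = 0 →
      ∑ j ∈ Finset.univ.erase i, |Λ i j| * ((e i : ℝ) - e j) < 0 := by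
  obtain ⟨d, hd⟩ := exists_rank Λ hΛ
  obtain ⟨B, hB⟩ : ∃ B : ℕ, ∀ i j, Λ i j ≠ 0 → (∑ k, |Λ i k|) / |Λ i j| + 1 < B := by
    obtain ⟨B, hB⟩ := exists_nat_gt (∑ i, ∑ j, ((∑ k, |Λ i k|) / |Λ i j| + 1))
    refine ⟨B, fun i j _ => lt_of_le_of_lt ?_ hB⟩
    have hnn : ∀ i j, 0 ≤ (∑ k, |Λ i k|) / |Λ i j| + 1 := fun i j => by positivity
    exact (Finset.single_le_sum (f := fun j => (∑ k, |Λ i k|) / |Λ i j| + 1)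
      (fun j _ => hnn i j) (Finset.mem_univ j)).trans
      (Finset.single_le_sum (f := fun i => ∑ j, ((∑ k, |Λ i k|) / |Λ i j| + 1))
      (fun i _ => Finset.sum_nonneg fun j _ => hnn i j) (Finset.mem_univ i))
  have hD : ∀ i, d i ≤ ∑ i, d i := fun i =>
    Finset.single_le_sum (fun _ _ => Nat.zero_le _) (Finset.mem_univ i)
  refine ⟨fun i => B ^ ((∑ i, d i) - d i), fun i hi => ?_⟩
  obtain ⟨j, hj, hji⟩ := hd i hi
  have hne : j ≠ i := by rintro rfl; exact lt_irrefl _ hji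
  have hpos : 0 < |Λ i j| := abs_pos.2 hj
  have hBij := hB i j hj
  have hSnn : 0 ≤ (∑ k, |Λ i k|) / |Λ i j| := by positivity
  have hB1 : (1 : ℝ) < B := by linarith
  have hB1' : 1 ≤ B := by exact_mod_cast hB1.le
  have hS : (∑ k, |Λ i k|) < |Λ i j| * (B - 1) := by
    have : (∑ k, |Λ i k|) / |Λ i j| < B - 1 := by linarith
    rw [div_lt_iff₀ hpos] at this
    linarith
  have hS2 : ∑ k ∈ (Finset.univ.erase i).erase j, |Λ i k| ≤ ∑ k, |Λ i k| :=
    Finset.sum_le_sum_of_subset_of_nonneg (Finset.subset_univ _) (fun _ _ _ => abs_nonneg _)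
  rw [← Finset.add_sum_erase _ _ (Finset.mem_erase.2 ⟨hne, Finset.mem_univ j⟩)]
  push_cast
  set E : ℝ := (B : ℝ) ^ ((∑ i, d i) - d i) with hE
  have hEpos : 0 < E := by positivity
  have hEj : (B : ℝ) * E ≤ (B : ℝ) ^ ((∑ i, d i) - d j) := by
    rw [hE, ← pow_succ']
    apply pow_le_pow_right₀ hB1.le
    have := hD i
    omega
  have h1 : ∑ k ∈ (Finset.univ.erase i).erase j,
      |Λ i k| * (E - (B : ℝ) ^ ((∑ i, d i) - d k)) ≤ (∑ k, |Λ i k|) * E := by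
    refine le_trans ?_ (mul_le_mul_of_nonneg_right hS2 hEpos.le)
    rw [Finset.sum_mul]
    refine Finset.sum_le_sum fun k _ => mul_le_mul_of_nonneg_left ?_ (abs_nonneg _)
    have : (0 : ℝ) ≤ (B : ℝ) ^ ((∑ i, d i) - d k) := by positivity
    linarith
  have h2 : |Λ i j| * (E - (B : ℝ) ^ ((∑ i, d i) - d j)) ≤ |Λ i j| * (E - B * E) :=
    mul_le_mul_of_nonneg_left (by linarith) hpos.le
  have h3 := mul_lt_mul_of_pos_right hS hEpos
  nlinarith

/-- If `Λ` is weakly contractive then there are `θ̄ > 0` and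
exponents `m_1, …, m_m` such that for every `θ ∈ (0, θ̄)` there is `c < 0`
with `μ_∞(P_θ Λ P_θ⁻¹) ≤ c < 0`, where
`P_θ = diag((1+θ)^{m_1}, …, (1+θ)^{m_m})`. -/
theorem stmt12 {m : ℕ} (hm : 0 < m) (Λ : Matrix (Fin m) (Fin m) ℝ)
    (hΛ : WeaklyContractive Λ) :
    ∃ θbar : ℝ, 0 < θbar ∧ ∃ mexp : Fin m → ℕ,
      ∀ θ : ℝ, 0 < θ → θ < θbar →
        ∃ c : ℝ, c < 0 ∧
          muInf (Matrix.diagonal (fun i => ((1 + θ) ^ mexp i : ℝ)) * Λ *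
            Matrix.diagonal (fun i => (((1 + θ) ^ mexp i : ℝ))⁻¹)) ≤ c := by
  obtain ⟨e, he⟩ := exists_exps Λ hΛ
  have key : ∀ i, ∀ᶠ x in nhdsWithin (0 : ℝ) (Set.Ioi 0),
      Λ i i + ∑ j ∈ Finset.univ.erase i, |Λ i j| * ((1 + x) ^ e i * ((1 + x) ^ e j)⁻¹) < 0 := by
    intro i
    refine aux_neg (D := ∑ j ∈ Finset.univ.erase i, |Λ i j| * ((e i : ℝ) - e j)) ?_ ?_
    · exact (HasDerivAt.fun_sum fun j _ => (aux_deriv (e i) (e j)).const_mul _).const_add _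
    · simp only [add_zero, one_pow, inv_one, mul_one]
      rcases (hΛ.1 i).lt_or_eq with h | h
      · exact Or.inl h
      · exact Or.inr ⟨h, he i h⟩
  obtain ⟨u, hu, hsub⟩ := mem_nhdsGT_iff_exists_Ioo_subset.1 (Filter.eventually_all.2 key)
  refine ⟨u, hu, e, fun θ h0 h1 => ⟨_, ?_, le_rfl⟩⟩
  have hθ := hsub ⟨h0, h1⟩
  haveI : Nonempty (Fin m) := ⟨⟨0, hm⟩⟩
  unfold muInf
  obtain ⟨i, hi⟩ := exists_eq_ciSup_of_finite (f := fun i : Fin m =>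
    ((Matrix.diagonal (fun i => ((1 + θ) ^ e i : ℝ)) * Λ *
            Matrix.diagonal (fun i => (((1 + θ) ^ e i : ℝ))⁻¹)) i i +
      ∑ k ∈ Finset.univ.erase i, |(Matrix.diagonal (fun i => ((1 + θ) ^ e i : ℝ)) * Λ *
            Matrix.diagonal (fun i => (((1 + θ) ^ e i : ℝ))⁻¹)) i k|))
  rw [← hi]
  refine lt_of_eq_of_lt ?_ (hθ i)
  have hp : ∀ k, (0 : ℝ) < (1 + θ) ^ e k := fun k => by positivity
  simp only [Matrix.mul_diagonal, Matrix.diagonal_mul]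
  congr 1
  · have := (hp i).ne'
    field_simp
  · refine Finset.sum_congr rfl fun k _ => ?_
    rw [abs_mul, abs_mul, abs_of_pos (hp i), abs_of_pos (inv_pos.2 (hp k))]
    ring
end

section
/- Let Λ_1,…,Λ_s ∈ ℝ^{m×m} satisfy μ_∞(Λ_ℓ) ≤ 0 for every ℓ. If Σ_{ℓ=1}^s ρ*_ℓ Λ_ℓ is weakly contractive for at least one tuple (ρ*_1,…,ρ*_s) of strictly positive reals, then Σ_{ℓ=1}^s ρ_ℓ Λ_ℓ is weakly contractive for every tuple (ρ_1,…,ρ_s) of strictly positive reals. -/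
lemma abs_sum_transfer {s : ℕ} (a ρ ρ' : Fin s → ℝ) (h : ∀ l, 0 < ρ l) (h' : ∀ l, 0 < ρ' l)
    (he : |∑ l, ρ l * a l| = ∑ l, ρ l * |a l|) :
    |∑ l, ρ' l * a l| = ∑ l, ρ' l * |a l| := by
  rcases le_total 0 (∑ l, ρ l * a l) with hs | hs
  · rw [abs_of_nonneg hs] at he
    have hk := (Finset.sum_eq_sum_iff_of_le
      (fun l _ => mul_le_mul_of_nonneg_left (le_abs_self (a l)) (h l).le)).1 he
    have ha : ∀ l, a l = |a l| := fun l =>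
      mul_left_cancel₀ (h l).ne' (hk l (Finset.mem_univ l))
    rw [abs_of_nonneg (Finset.sum_nonneg fun l _ =>
      mul_nonneg (h' l).le (by rw [ha l]; exact abs_nonneg _))]
    exact Finset.sum_congr rfl fun l _ => by rw [← ha l]
  · rw [abs_of_nonpos hs, ← Finset.sum_neg_distrib] at he
    have hk := (Finset.sum_eq_sum_iff_of_le (f := fun l => -(ρ l * a l)) (s := Finset.univ)
      (g := fun l => ρ l * |a l|)
      (fun l _ => by
        have := mul_le_mul_of_nonneg_left (neg_le_abs (a l)) (h l).le
        linarith)).1 he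
    have ha : ∀ l, -a l = |a l| := fun l =>
      mul_left_cancel₀ (h l).ne' (by have := hk l (Finset.mem_univ l); linarith)
    have h2 : ∑ l, ρ' l * a l = -∑ l, ρ' l * |a l| := by
      rw [← Finset.sum_neg_distrib]
      exact Finset.sum_congr rfl fun l _ => by rw [← ha l]; ring
    rw [h2, abs_neg, abs_of_nonneg]
    exact Finset.sum_nonneg fun l _ => mul_nonneg (h' l).le (abs_nonneg _)

lemma abs_sum_le' {s : ℕ} (a ρ : Fin s → ℝ) (h : ∀ l, 0 < ρ l) :
    |∑ l, ρ l * a l| ≤ ∑ l, ρ l * |a l| := by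
  refine (Finset.abs_sum_le_sum_abs _ _).trans (le_of_eq ?_)
  exact Finset.sum_congr rfl fun l _ => by rw [abs_mul, abs_of_pos (h l)]

lemma comb_apply {m s : ℕ} (Λ : Fin s → Matrix (Fin m) (Fin m) ℝ) (ρ : Fin s → ℝ) (i j : Fin m) :
    (∑ l, ρ l • Λ l) i j = ∑ l, ρ l * Λ l i j := by
  simp [Matrix.sum_apply]

lemma sum_sigma {m s : ℕ} (Λ : Fin s → Matrix (Fin m) (Fin m) ℝ) (ρ : Fin s → ℝ) (i : Fin m) :
    ∑ l, ρ l * sigmaRow (Λ l) i = ∑ l, ρ l * Λ l i i +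
      ∑ j ∈ Finset.univ.erase i, ∑ l, ρ l * |Λ l i j| := by
  rw [Finset.sum_comm, ← Finset.sum_add_distrib]
  exact Finset.sum_congr rfl fun l _ => by rw [sigmaRow, mul_add, Finset.mul_sum]

lemma sigma_comb_le {m s : ℕ} (Λ : Fin s → Matrix (Fin m) (Fin m) ℝ) (ρ : Fin s → ℝ)
    (h : ∀ l, 0 < ρ l) (i : Fin m) :
    sigmaRow (∑ l, ρ l • Λ l) i ≤ ∑ l, ρ l * sigmaRow (Λ l) i := by
  rw [sum_sigma]
  simp only [sigmaRow, comb_apply]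
  gcongr with j _
  exact abs_sum_le' _ _ h

lemma row_transfer {m s : ℕ} (Λ : Fin s → Matrix (Fin m) (Fin m) ℝ) (ρ ρ' : Fin s → ℝ)
    (h : ∀ l, 0 < ρ l) (h' : ∀ l, 0 < ρ' l) (i : Fin m) (hΛ : ∀ l, sigmaRow (Λ l) i ≤ 0)
    (h0 : sigmaRow (∑ l, ρ l • Λ l) i = 0) :
    sigmaRow (∑ l, ρ' l • Λ l) i = 0 ∧
      ∀ j, (∑ l, ρ l • Λ l) i j ≠ 0 → (∑ l, ρ' l • Λ l) i j ≠ 0 := by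
  have hnp : ∀ l ∈ Finset.univ, ρ l * sigmaRow (Λ l) i ≤ 0 := fun l _ =>
    mul_nonpos_of_nonneg_of_nonpos (h l).le (hΛ l)
  have hle := sigma_comb_le Λ ρ h i
  have hS : ∑ l, ρ l * sigmaRow (Λ l) i = 0 :=
    le_antisymm (Finset.sum_nonpos hnp) (by linarith)
  have hz : ∀ l, sigmaRow (Λ l) i = 0 := fun l =>
    (mul_eq_zero.1 ((Finset.sum_eq_zero_iff_of_nonpos hnp).1 hS l (Finset.mem_univ l))).resolve_left
      (h l).ne'
  have hoff : ∀ j ∈ Finset.univ.erase i,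
      |∑ l, ρ l * Λ l i j| = ∑ l, ρ l * |Λ l i j| := by
    refine (Finset.sum_eq_sum_iff_of_le (fun j _ => abs_sum_le' _ _ h)).1 ?_
    rw [sum_sigma] at hS
    simp only [sigmaRow, comb_apply] at h0
    linarith
  have hdiag : ∀ l, Λ l i i ≤ 0 := fun l => by
    have h1 := hΛ l
    have h2 : 0 ≤ ∑ j ∈ Finset.univ.erase i, |Λ l i j| :=
      Finset.sum_nonneg fun _ _ => abs_nonneg _
    unfold sigmaRow at h1
    linarith
  have hoff' : ∀ j, |∑ l, ρ' l * Λ l i j| = ∑ l, ρ' l * |Λ l i j| := by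
    intro j
    by_cases hj : j = i
    · subst hj
      rw [abs_of_nonpos (Finset.sum_nonpos fun l _ =>
        mul_nonpos_of_nonneg_of_nonpos (h' l).le (hdiag l)), ← Finset.sum_neg_distrib]
      exact Finset.sum_congr rfl fun l _ => by rw [abs_of_nonpos (hdiag l)]; ring
    · exact abs_sum_transfer _ _ _ h h' (hoff j (by simp [hj]))
  constructor
  · have h3 : ∑ l, ρ' l * sigmaRow (Λ l) i = 0 := by simp [hz]
    rw [sum_sigma] at h3
    simp only [sigmaRow, comb_apply, hoff']
    exact h3
  · intro j hne hc
    apply hne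
    rw [comb_apply] at hc ⊢
    have h4 := hoff' j
    rw [hc, abs_zero] at h4
    have h5 := (Finset.sum_eq_zero_iff_of_nonneg
      (fun l _ => mul_nonneg (h' l).le (abs_nonneg (Λ l i j)))).1 h4.symm
    refine Finset.sum_eq_zero fun l hl => ?_
    have h6 := (mul_eq_zero.1 (h5 l hl)).resolve_left (h' l).ne'
    rw [abs_eq_zero.1 h6, mul_zero]

/-- If `μ_∞(Λ_ℓ) ≤ 0` for every `ℓ` and `Σ_ℓ ρ*_ℓ Λ_ℓ` is weakly
contractive for one tuple of strictly positive reals, then `Σ_ℓ ρ_ℓ Λ_ℓ` is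
weakly contractive for every tuple of strictly positive reals. -/
theorem stmt13 {m s : ℕ} (Λ : Fin s → Matrix (Fin m) (Fin m) ℝ)
    (hΛ : ∀ ℓ, muInf (Λ ℓ) ≤ 0)
    (ρstar : Fin s → ℝ) (hρstar : ∀ ℓ, 0 < ρstar ℓ)
    (hwc : WeaklyContractive (∑ ℓ : Fin s, ρstar ℓ • Λ ℓ)) :
    ∀ ρ : Fin s → ℝ, (∀ ℓ, 0 < ρ ℓ) →
      WeaklyContractive (∑ ℓ : Fin s, ρ ℓ • Λ ℓ) := by
  intro ρ hρ
  have hσ : ∀ i l, sigmaRow (Λ l) i ≤ 0 := fun i l =>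
    (le_ciSup (f := fun i => Λ l i i + ∑ k ∈ Finset.univ.erase i, |Λ l i k|)
      (Set.finite_range _).bddAbove i).trans (hΛ l)
  have hle : ∀ i, sigmaRow (∑ l, ρ l • Λ l) i ≤ 0 := fun i =>
    (sigma_comb_le Λ ρ hρ i).trans (Finset.sum_nonpos fun l _ =>
      mul_nonpos_of_nonneg_of_nonpos (hρ l).le (hσ i l))
  refine ⟨hle, fun i hi => ?_⟩
  obtain ⟨k, c, hc0, hc1, hc2, hc3⟩ :=
    hwc.2 i (row_transfer Λ ρ ρstar hρ hρstar i (hσ i) hi).1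
  have key := fun t => row_transfer Λ ρstar ρ hρstar hρ _ (hσ _) (hc2 t)
  refine ⟨k, c, hc0, fun t => (key t).2 _ (hc1 t), fun t => (key t).1, ?_⟩
  refine lt_of_le_of_ne (hle _) fun h => hc3.ne ?_
  exact (row_transfer Λ ρ ρstar hρ hρstar _ (hσ _) h).1
end
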